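/- arXiv:2510.08549 — 4 statements merged into one kernel-verified Lean document; each statement's English description precedes it below -/
import Mathlib

section
/- Let D ≥ 1 be a natural number, let σ_min, σ_max be positive reals with σ_min ≤ σ_max, and let H₀' be a real number satisfying H₀' ≤ D·log(σ_max·√(2πe)). For any vector σ̂ ∈ ℝ^D, set pᵢ = softmax(σ̂)ᵢ and define σ'ᵢ by log σ'ᵢ = max( log σ_max + (H₀' − D·log √(2πe) − D·log σ_max)·pᵢ , log σ_min ) for each i. Then (i) σ_min ≤ σ'ᵢ ≤ σ_max for every i, and (ii) (D/2)·log(2πe) + Σ_{i=1}^{D} log σ'ᵢ ≥ H₀'; that is, the differential entropy of the D-dimensional Gaussian with independent coordinates of standard deviations σ'₁,…,σ'_D is at least H₀'. -/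
open Real Finset

/-- **Continuous ERA entropy guarantee (Proposition C.1).**
Given `D ≥ 1`, `0 < σmin ≤ σmax`, and a target `H₀' ≤ D·log(σmax·√(2πe))`,
the ERA activation `σ'ᵢ = exp (max (log σmax + (H₀' − D·log √(2πe) − D·log σmax)·softmax(σ̂)ᵢ,
log σmin))` produces standard deviations in `[σmin, σmax]` whose Gaussian entropy
`(D/2)·log(2πe) + Σᵢ log σ'ᵢ` is at least `H₀'`. -/
theorem era_continuous_entropy_bound
    (D : ℕ) (hD : 1 ≤ D)
    (σmin σmax : ℝ) (hσmin : 0 < σmin) (hσmax : 0 < σmax) (hminmax : σmin ≤ σmax)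
    (H₀' : ℝ)
    (hH : H₀' ≤ (D : ℝ) * Real.log (σmax * Real.sqrt (2 * Real.pi * Real.exp 1)))
    (σhat : Fin D → ℝ)
    (p : Fin D → ℝ)
    (hp : ∀ i, p i = Real.exp (σhat i) / ∑ j, Real.exp (σhat j))
    (σ' : Fin D → ℝ)
    (hσ' : ∀ i, σ' i = Real.exp (max
      (Real.log σmax +
        (H₀' - (D : ℝ) * Real.log (Real.sqrt (2 * Real.pi * Real.exp 1))
          - (D : ℝ) * Real.log σmax) * p i)
      (Real.log σmin))) :
    (∀ i, σmin ≤ σ' i ∧ σ' i ≤ σmax) ∧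
      H₀' ≤ (D : ℝ) / 2 * Real.log (2 * Real.pi * Real.exp 1) + ∑ i, Real.log (σ' i) := by
  have : Nonempty (Fin D) := ⟨⟨0, hD⟩⟩
  have hZ : 0 < ∑ j, Real.exp (σhat j) :=
    Finset.sum_pos (fun j _ => Real.exp_pos _) Finset.univ_nonempty
  have hp_nonneg : ∀ i, 0 ≤ p i := fun i => by
    rw [hp]
    positivity
  have hp_sum : ∑ i, p i = 1 := by
    simp_rw [hp]
    rw [← Finset.sum_div, div_self hZ.ne']
  have hc : 0 < 2 * Real.pi * Real.exp 1 := by positivity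
  rw [Real.log_mul hσmax.ne' (Real.sqrt_pos.mpr hc).ne'] at hH
  refine ⟨fun i => ?_, ?_⟩
  · rw [hσ', ← Real.log_le_iff_le_exp hσmin, ← Real.le_log_iff_exp_le hσmax]
    refine ⟨le_max_right _ _, max_le ?_ (Real.log_le_log hσmin hminmax)⟩
    have := mul_nonpos_of_nonpos_of_nonneg (show H₀' -
      (D : ℝ) * Real.log (Real.sqrt (2 * Real.pi * Real.exp 1))
        - (D : ℝ) * Real.log σmax ≤ 0 by linarith) (hp_nonneg i)
    linarith
  · have hsum := Finset.sum_le_sum fun i (_ : i ∈ (Finset.univ : Finset (Fin D))) =>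
      (le_max_left _ _).trans_eq ((congrArg Real.log (hσ' i)).trans (Real.log_exp _)).symm
    rw [Finset.sum_add_distrib, ← Finset.mul_sum, hp_sum, Finset.sum_const, Finset.card_univ,
      Fintype.card_fin, nsmul_eq_mul, Real.log_sqrt hc.le] at hsum
    linarith
end

section
/- Let D ≥ 2 be a natural number, let τ ≥ e, let H₀ be a real number, and set C = exp(H₀ − 1). Assume (log τ)/τ ≤ C ≤ D·(log τ)/τ. Let p ∈ ℝ^D be a probability vector (pᵢ ≥ 0, Σᵢ pᵢ = 1), and define κᵢ = max( (log τ)/τ + (C − D·(log τ)/τ)·(1 − pᵢ)/(D − 1) , 0 ) for each i. For each i let z'ᵢ ∈ [−1, 0] be the unique real number with −z'ᵢ·e^{z'ᵢ} = κᵢ. Then the Shannon entropy of the probability vector softmax(z') satisfies H(softmax(z')) ≥ H₀. -/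
open Real Finset

/-- The Shannon entropy of `softmax z` is the log-partition function minus the mean of `z`. -/
theorem entropy_softmax_eq {ι : Type*} [Fintype ι] [Nonempty ι] (z : ι → ℝ) :
    -∑ i, (Real.exp (z i) / ∑ j, Real.exp (z j)) *
        Real.log (Real.exp (z i) / ∑ j, Real.exp (z j)) =
      Real.log (∑ j, Real.exp (z j)) +
        (∑ i, -z i * Real.exp (z i)) / ∑ j, Real.exp (z j) := by
  have hS : 0 < ∑ j, Real.exp (z j) :=
    Finset.sum_pos (fun i _ => Real.exp_pos _) Finset.univ_nonempty
  set S := ∑ j, Real.exp (z j) with hSdef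
  have hterm (i : ι) : Real.exp (z i) / S * Real.log (Real.exp (z i) / S) =
      -(-z i * Real.exp (z i) / S) - Real.exp (z i) * (Real.log S / S) := by
    rw [Real.log_div (Real.exp_ne_zero _) hS.ne', Real.log_exp]
    ring
  simp_rw [hterm]
  rw [Finset.sum_sub_distrib, Finset.sum_neg_distrib, ← Finset.sum_div, ← Finset.sum_mul,
    ← hSdef, mul_div_cancel₀ _ hS.ne']
  ring

/-- For fixed `c > 0`, the function `s ↦ log s + c / s` attains its minimum at `s = c`. -/
theorem log_add_one_le_log_add_div {c s : ℝ} (hc : 0 < c) (hs : 0 < s) :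
    Real.log c + 1 ≤ Real.log s + c / s := by
  have h := Real.log_le_sub_one_of_pos (div_pos hc hs)
  rw [Real.log_div hc.ne' hs.ne'] at h
  linarith

/-- Distributing the mass `c - D * a` proportionally to `1 - p i` on top of the constant `a`
yields total mass `c`. -/
theorem sum_add_mul_one_sub_div {D : ℕ} (hD : 2 ≤ D) (a c : ℝ) {p : Fin D → ℝ}
    (hp : ∑ i, p i = 1) :
    ∑ i, (a + (c - (D : ℝ) * a) * ((1 - p i) / ((D : ℝ) - 1))) = c := by
  have hD' : (D : ℝ) - 1 ≠ 0 := by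
    have : (2 : ℝ) ≤ D := by exact_mod_cast hD
    linarith
  rw [Finset.sum_add_distrib, ← Finset.mul_sum, ← Finset.sum_div, Finset.sum_sub_distrib, hp]
  simp [div_self hD']

/-- **Discrete ERA entropy guarantee (Proposition C.2).**
Given `D ≥ 2`, `τ ≥ e`, a target entropy `H₀` with `C = exp(H₀ − 1)` satisfying
`(log τ)/τ ≤ C ≤ D·(log τ)/τ`, and a probability vector `p`, let
`κᵢ = max((log τ)/τ + (C − D·(log τ)/τ)·(1 − pᵢ)/(D − 1), 0)` and let `z'ᵢ ∈ [−1,0]` be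
the unique solution of `−z'ᵢ·e^{z'ᵢ} = κᵢ`. Then the Shannon entropy of `softmax z'`
is at least `H₀`. -/
theorem era_discrete_entropy_bound
    (D : ℕ) (hD : 2 ≤ D)
    (τ : ℝ) (hτ : Real.exp 1 ≤ τ)
    (H₀ C : ℝ) (hC : C = Real.exp (H₀ - 1))
    (hClb : Real.log τ / τ ≤ C)
    (hCub : C ≤ (D : ℝ) * (Real.log τ / τ))
    (p : Fin D → ℝ) (hp0 : ∀ i, 0 ≤ p i) (hp1 : ∑ i, p i = 1)
    (κ : Fin D → ℝ)
    (hκ : ∀ i, κ i = max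
      (Real.log τ / τ + (C - (D : ℝ) * (Real.log τ / τ)) * ((1 - p i) / ((D : ℝ) - 1))) 0)
    (z' : Fin D → ℝ)
    (hz'mem : ∀ i, z' i ∈ Set.Icc (-1 : ℝ) 0)
    (hz'eq : ∀ i, -z' i * Real.exp (z' i) = κ i) :
    H₀ ≤ -∑ i, (Real.exp (z' i) / ∑ j, Real.exp (z' j)) *
        Real.log (Real.exp (z' i) / ∑ j, Real.exp (z' j)) := by
  have : Nonempty (Fin D) := ⟨⟨0, by lia⟩⟩
  have hS : 0 < ∑ j, Real.exp (z' j) :=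
    Finset.sum_pos (fun i _ => Real.exp_pos _) Finset.univ_nonempty
  have hCpos : 0 < C := hC ▸ Real.exp_pos _
  have hK : C ≤ ∑ i, -z' i * Real.exp (z' i) := by
    rw [← sum_add_mul_one_sub_div hD (Real.log τ / τ) C hp1]
    refine Finset.sum_le_sum fun i _ => ?_
    rw [hz'eq, hκ]
    exact le_max_left _ _
  calc H₀ = Real.log C + 1 := by rw [hC, Real.log_exp]; ring
    _ ≤ Real.log (∑ j, Real.exp (z' j)) + C / ∑ j, Real.exp (z' j) :=
      log_add_one_le_log_add_div hCpos hS
    _ ≤ Real.log (∑ j, Real.exp (z' j)) +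
        (∑ i, -z' i * Real.exp (z' i)) / ∑ j, Real.exp (z' j) := by gcongr
    _ = _ := (entropy_softmax_eq z').symm
end

section
/- Let D ≥ 1 and let z ∈ ℝ^D be any vector such that T := Σ_{i=1}^{D} (−zᵢ·e^{zᵢ}) > 0, and set S := Σ_{i=1}^{D} e^{zᵢ}. Then the Shannon entropy of p = softmax(z) satisfies H(p) = T/S + log S, and consequently H(p) ≥ 1 + log T. -/
open Real Finset

/-- **Key lemma for the discrete ERA entropy bound.**
For any `z ∈ ℝ^D` with `T = Σᵢ (−zᵢ·e^{zᵢ}) > 0` and `S = Σᵢ e^{zᵢ}`, the Shannon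
entropy of `softmax z` equals `T/S + log S`, and consequently is at least `1 + log T`. -/
theorem softmax_entropy_eq_and_lower_bound
    (D : ℕ) (hD : 1 ≤ D)
    (z : Fin D → ℝ)
    (T S : ℝ)
    (hT : T = ∑ i, (-z i * Real.exp (z i)))
    (hS : S = ∑ i, Real.exp (z i))
    (hTpos : 0 < T) :
    (-∑ i, (Real.exp (z i) / S) * Real.log (Real.exp (z i) / S)) = T / S + Real.log S ∧
      1 + Real.log T ≤ -∑ i, (Real.exp (z i) / S) * Real.log (Real.exp (z i) / S) := by
  have hSpos : 0 < S :=
    hS ▸ Finset.sum_pos (fun i _ => Real.exp_pos (z i)) ⟨⟨0, hD⟩, Finset.mem_univ _⟩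
  have entropy_eq :
      (-∑ i, (Real.exp (z i) / S) * Real.log (Real.exp (z i) / S)) = T / S + Real.log S := by
    have hterm (i : Fin D) : (Real.exp (z i) / S) * Real.log (Real.exp (z i) / S) =
        -(-z i * Real.exp (z i) / S) - Real.exp (z i) / S * Real.log S := by
      rw [Real.log_div (Real.exp_ne_zero _) hSpos.ne', Real.log_exp]
      ring
    rw [Finset.sum_congr rfl fun i _ => hterm i, Finset.sum_sub_distrib, Finset.sum_neg_distrib,
      ← Finset.sum_div, ← Finset.sum_mul, ← Finset.sum_div, ← hT, ← hS, div_self hSpos.ne']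
    ring
  refine ⟨entropy_eq, ?_⟩
  rw [entropy_eq]
  have hlog := Real.log_le_sub_one_of_pos (div_pos hTpos hSpos)
  rw [Real.log_div hTpos.ne' hSpos.ne'] at hlog
  linarith
end

section
/- Fix D ≥ 1, a point z₀ ∈ ℝ^D, and a real k > 0. Set π = softmax(z₀) and π' = softmax(k·z₀). Let A ∈ ℝ^D satisfy Σᵢ πᵢ·Aᵢ = 0, and set C = Σ_{i : Aᵢ > 0} πᵢ·Aᵢ. Define F : ℝ^D → ℝ by F(z) = Σ_{i : Aᵢ > 0} πᵢ·(Aᵢ/k)·log softmax(k·z)ᵢ + Σ_{i : Aᵢ < 0} πᵢ·Aᵢ·log softmax(z)ᵢ (the weights πᵢ and advantages Aᵢ held fixed at their values at z₀). Then for every index a, the partial derivative of F with respect to z_a, evaluated at z₀, equals π_a·A_a − C·(π'_a − π_a). -/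
open Real Finset

/-- The softmax map on `ℝ^D`. -/
noncomputable def softmax {D : ℕ} (z : Fin D → ℝ) (i : Fin D) : ℝ :=
  Real.exp (z i) / ∑ j, Real.exp (z j)

/-- The log-sum-exp formula for the logarithm of the softmax. -/
theorem log_softmax {D : ℕ} (z : Fin D → ℝ) (i : Fin D) :
    Real.log (softmax z i) = z i - Real.log (∑ j, Real.exp (z j)) := by
  have : 0 < ∑ j, Real.exp (z j) :=
    Finset.sum_pos (fun j _ => Real.exp_pos _) ⟨i, Finset.mem_univ i⟩
  rw [softmax, Real.log_div (Real.exp_pos _).ne' this.ne', Real.log_exp]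

theorem hasFDerivAt_log_softmax {D : ℕ} (z : Fin D → ℝ) (i : Fin D) :
    HasFDerivAt (fun z : Fin D → ℝ => Real.log (softmax z i))
      (ContinuousLinearMap.proj (R := ℝ) (φ := fun _ : Fin D => ℝ) i -
        ∑ j, softmax z j • ContinuousLinearMap.proj (R := ℝ) (φ := fun _ : Fin D => ℝ) j) z := by
  have hpos : 0 < ∑ j, Real.exp (z j) :=
    Finset.sum_pos (fun j _ => Real.exp_pos _) ⟨i, Finset.mem_univ i⟩
  simp only [log_softmax]
  have hsum : HasFDerivAt (fun z : Fin D → ℝ => ∑ j, Real.exp (z j)) _ z :=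
    HasFDerivAt.fun_sum fun j _ => (hasFDerivAt_apply (𝕜 := ℝ) j z).exp
  refine ((hasFDerivAt_apply (𝕜 := ℝ) i z).sub (hsum.log hpos.ne')).congr_fderiv ?_
  simp only [Finset.smul_sum, smul_smul, softmax, div_eq_inv_mul]

theorem hasFDerivAt_log_softmax_smul {D : ℕ} (k : ℝ) (z : Fin D → ℝ) (i : Fin D) :
    HasFDerivAt (fun z : Fin D → ℝ => Real.log (softmax (k • z) i))
      (k • (ContinuousLinearMap.proj (R := ℝ) (φ := fun _ : Fin D => ℝ) i -
        ∑ j, softmax (k • z) j •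
          ContinuousLinearMap.proj (R := ℝ) (φ := fun _ : Fin D => ℝ) j)) z := by
  refine ((hasFDerivAt_log_softmax (k • z) i).comp z
    ((hasFDerivAt_id z).const_smul k)).congr_fderiv ?_
  ext v
  simp

/-- A weighted sum of the derivatives of the log-softmax in one coordinate direction. -/
theorem sum_mul_single_sub {D : ℕ} (s : Finset (Fin D)) (w : Fin D → ℝ) (a : Fin D) (p : ℝ) :
    ∑ i ∈ s, w i * ((Pi.single a 1 : Fin D → ℝ) i - p) =
      (if a ∈ s then w a else 0) - (∑ i ∈ s, w i) * p := by
  simp [mul_sub, Finset.sum_sub_distrib, Finset.sum_mul, Pi.single_apply]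

/-- A sum splits into its parts over the positive and the negative values of `A`. -/
theorem sum_mul_eq_sum_pos_add_sum_neg {ι : Type*} [Fintype ι] (w A : ι → ℝ) :
    ∑ i, w i * A i = ∑ i ∈ Finset.univ.filter (fun i => 0 < A i), w i * A i +
      ∑ i ∈ Finset.univ.filter (fun i => A i < 0), w i * A i := by
  rw [Finset.sum_filter, Finset.sum_filter, ← Finset.sum_add_distrib]
  refine Finset.sum_congr rfl fun i _ => ?_
  rcases lt_trichotomy (A i) 0 with h | h | h
  · simp [h, h.not_gt]
  · simp [h]
  · simp [h, h.not_gt]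

/-- **Gradient of the ERA-adjusted policy-gradient objective (Eq. 25).**
With `π = softmax z₀`, `π' = softmax (k·z₀)`, zero-mean advantages, and
`C = Σ_{i : Aᵢ > 0} πᵢ·Aᵢ`, the ERA objective
`F(z) = Σ_{i : Aᵢ > 0} πᵢ·(Aᵢ/k)·log softmax(k·z)ᵢ + Σ_{i : Aᵢ < 0} πᵢ·Aᵢ·log softmax(z)ᵢ`
has partial derivative `πₐ·Aₐ − C·(π'ₐ − πₐ)` in coordinate `a` at `z₀`. -/
theorem era_llm_objective_partial_deriv (D : ℕ) (hD : 1 ≤ D)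
    (z₀ : Fin D → ℝ) (k : ℝ) (hk : 0 < k)
    (A : Fin D → ℝ) (hA : ∑ i, softmax z₀ i * A i = 0)
    (C : ℝ) (hC : C = ∑ i ∈ Finset.univ.filter (fun i => 0 < A i), softmax z₀ i * A i)
    (F : (Fin D → ℝ) → ℝ)
    (hF : ∀ z, F z =
      (∑ i ∈ Finset.univ.filter (fun i => 0 < A i),
        softmax z₀ i * (A i / k) * Real.log (softmax (k • z) i)) +
      ∑ i ∈ Finset.univ.filter (fun i => A i < 0),
        softmax z₀ i * A i * Real.log (softmax z i))
    (a : Fin D) :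
    DifferentiableAt ℝ F z₀ ∧
      fderiv ℝ F z₀ (Pi.single a 1) =
        softmax z₀ a * A a - C * (softmax (k • z₀) a - softmax z₀ a) := by
  have hpos_deriv := HasFDerivAt.fun_sum (u := Finset.univ.filter fun i => 0 < A i) fun i _ =>
    (hasFDerivAt_log_softmax_smul k z₀ i).const_mul (softmax z₀ i * (A i / k))
  have hneg_deriv := HasFDerivAt.fun_sum (u := Finset.univ.filter fun i => A i < 0) fun i _ =>
    (hasFDerivAt_log_softmax z₀ i).const_mul (softmax z₀ i * A i)
  have hF' := (hpos_deriv.add hneg_deriv).congr_of_eventuallyEq (.of_forall hF)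
  refine ⟨hF'.differentiableAt, ?_⟩
  have hneg : ∑ i ∈ Finset.univ.filter (fun i => A i < 0), softmax z₀ i * A i = -C := by
    rw [sum_mul_eq_sum_pos_add_sum_neg] at hA
    linarith
  have hsum (p : Fin D → ℝ) : ∑ j, p j * (Pi.single a 1 : Fin D → ℝ) j = p a := by
    simp [Pi.single_apply]
  have hcancel (i : Fin D) (x : ℝ) :
      softmax z₀ i * (A i / k) * (k * x) = softmax z₀ i * A i * x := by
    field_simp
  rw [hF'.fderiv]
  simp only [add_apply, _root_.sum_apply,
    smul_apply, sub_apply,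
    ContinuousLinearMap.proj_apply, smul_eq_mul, hsum, hcancel]
  rw [sum_mul_single_sub _ (fun i => softmax z₀ i * A i),
    sum_mul_single_sub _ (fun i => softmax z₀ i * A i), hneg, ← hC]
  rcases lt_trichotomy (A a) 0 with h | h | h
  · simp [h, h.not_gt]; ring
  · simp [h]; ring
  · simp [h, h.not_gt]; ring
end
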